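/- There exist infinitely many C^∞ free boundary saddle disks in the closed unit ball of ℝ³ which are not equatorial. Precisely: there exists an infinite family of C^∞ maps ψ from the closed unit disk D̄ ⊂ ℝ² into the closed unit ball of ℝ³, with pairwise distinct images, such that each ψ satisfies: (i) ψ is an immersion, i.e. the partial derivatives ψ_x(p) and ψ_y(p) are linearly independent at every p ∈ D̄; (ii) ‖ψ(p)‖ = 1 if and only if p lies on the boundary circle ∂D̄; (iii) at every boundary point p ∈ ∂D̄ the position vector is tangent to the surface, i.e. ⟨ψ(p), ψ_x(p) × ψ_y(p)⟩ = 0 (the surface meets the unit sphere orthogonally: the free boundary condition); (iv) at every p ∈ D̄, writing n(p) = ψ_x(p) × ψ_y(p), one has ⟨ψ_xx(p), n(p)⟩·⟨ψ_yy(p), n(p)⟩ − ⟨ψ_xy(p), n(p)⟩² ≤ 0 (the surface is saddle, i.e. its Gaussian curvature is nonpositive); (v) the image ψ(D̄) is not contained in any affine plane of ℝ³ (the disk is not equatorial). -/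

import Mathlib

open Real Set

noncomputable section

/-- Euclidean dot product on `ℝ²` (represented as `ℝ × ℝ`). -/
def dot2 (a b : ℝ × ℝ) : ℝ := a.1 * b.1 + a.2 * b.2

/-- Determinant of two vectors in `ℝ²`. -/
def det2 (a b : ℝ × ℝ) : ℝ := a.1 * b.2 - a.2 * b.1

/-- Euclidean norm on `ℝ²`. -/
def norm2 (a : ℝ × ℝ) : ℝ := Real.sqrt (a.1 ^ 2 + a.2 ^ 2)

/-- Euclidean dot product on `ℝ³` (represented as `ℝ × ℝ × ℝ`). -/
def dot3 (a b : ℝ × ℝ × ℝ) : ℝ := a.1 * b.1 + a.2.1 * b.2.1 + a.2.2 * b.2.2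

/-- Cross product on `ℝ³`. -/
def cross3 (a b : ℝ × ℝ × ℝ) : ℝ × ℝ × ℝ :=
  (a.2.1 * b.2.2 - a.2.2 * b.2.1, a.2.2 * b.1 - a.1 * b.2.2, a.1 * b.2.1 - a.2.1 * b.1)

/-- Euclidean norm on `ℝ³`. -/
def norm3 (a : ℝ × ℝ × ℝ) : ℝ := Real.sqrt (a.1 ^ 2 + a.2.1 ^ 2 + a.2.2 ^ 2)

/-- The closed unit disk `D̄ ⊂ ℝ²`. -/
def ClosedDisk : Set (ℝ × ℝ) := {p | norm2 p ≤ 1}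

/-- The partial derivative `ψ_x`. -/
def pderivX (ψ : ℝ × ℝ → ℝ × ℝ × ℝ) (p : ℝ × ℝ) : ℝ × ℝ × ℝ :=
  deriv (fun s => ψ (s, p.2)) p.1

/-- The partial derivative `ψ_y`. -/
def pderivY (ψ : ℝ × ℝ → ℝ × ℝ × ℝ) (p : ℝ × ℝ) : ℝ × ℝ × ℝ :=
  deriv (fun t => ψ (p.1, t)) p.2

/-- The second partial derivative `ψ_xx`. -/
def pderivXX (ψ : ℝ × ℝ → ℝ × ℝ × ℝ) : (ℝ × ℝ) → ℝ × ℝ × ℝ := pderivX (pderivX ψ)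

/-- The second partial derivative `ψ_xy`. -/
def pderivXY (ψ : ℝ × ℝ → ℝ × ℝ × ℝ) : (ℝ × ℝ) → ℝ × ℝ × ℝ := pderivY (pderivX ψ)

/-- The second partial derivative `ψ_yy`. -/
def pderivYY (ψ : ℝ × ℝ → ℝ × ℝ × ℝ) : (ℝ × ℝ) → ℝ × ℝ × ℝ := pderivY (pderivY ψ)

/-- `ψ` is a `C^∞` non-equatorial free boundary saddle disk in the closed unit ball of `ℝ³`:
`ψ` is a smooth map of the closed unit disk into the closed unit ball which is an immersion,
touches the unit sphere exactly along the boundary circle, meets the sphere orthogonally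
there (free boundary), has nonpositive Gaussian curvature (saddle), and whose image is not
contained in any affine plane (non-equatorial). -/
def IsFreeBoundarySaddleDiskNonEquatorial (ψ : ℝ × ℝ → ℝ × ℝ × ℝ) : Prop :=
  ContDiff ℝ (⊤ : ℕ∞) ψ ∧
  (∀ p ∈ ClosedDisk, norm3 (ψ p) ≤ 1) ∧
  (∀ p ∈ ClosedDisk, LinearIndependent ℝ ![pderivX ψ p, pderivY ψ p]) ∧
  (∀ p ∈ ClosedDisk, (norm3 (ψ p) = 1 ↔ norm2 p = 1)) ∧
  (∀ p ∈ ClosedDisk, norm2 p = 1 →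
    dot3 (ψ p) (cross3 (pderivX ψ p) (pderivY ψ p)) = 0) ∧
  (∀ p ∈ ClosedDisk,
    dot3 (pderivXX ψ p) (cross3 (pderivX ψ p) (pderivY ψ p)) *
        dot3 (pderivYY ψ p) (cross3 (pderivX ψ p) (pderivY ψ p)) -
      dot3 (pderivXY ψ p) (cross3 (pderivX ψ p) (pderivY ψ p)) ^ 2 ≤ 0) ∧
  ¬ ∃ (w : ℝ × ℝ × ℝ) (b : ℝ), w ≠ 0 ∧ ∀ p ∈ ClosedDisk, dot3 w (ψ p) = b


lemma base_sigma : ∃ s s1 s2 : ℝ → ℝ, ContDiff ℝ (⊤ : ℕ∞) s ∧ (∀ t, HasDerivAt s (s1 t) t) ∧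
    (∀ t, HasDerivAt s1 (s2 t) t) ∧ (∀ t, s (-t) = - s t) ∧ (∀ t, s1 (-t) = s1 t) ∧
    (∀ t, 1 ≤ t → s t = 1) ∧ (∀ t, 1 ≤ |t| → s1 t = 0) ∧ (∀ t, 0 ≤ s1 t) ∧
    (∀ t u, 0 ≤ t → t ≤ u → s1 u ≤ s1 t) ∧ (0 < s1 (1/2)) := by
  have hbc : ContDiff ℝ (⊤ : ℕ∞) (fun t : ℝ => expNegInvGlue (1 - t^2)) :=
    expNegInvGlue.contDiff.comp (by fun_prop)
  obtain ⟨β, hβ⟩ : ∃ β : ℝ → ℝ, β = fun t : ℝ => expNegInvGlue (1 - t^2) := ⟨_, rfl⟩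
  rw [← hβ] at hbc
  have hcont : Continuous β := hbc.continuous
  have hnn : ∀ t, 0 ≤ β t := fun t => by rw [hβ]; exact expNegInvGlue.nonneg _
  have hmono : Monotone expNegInvGlue := by
    intro x y hxy
    by_cases hx : x ≤ 0
    · rw [expNegInvGlue.zero_of_nonpos hx]; exact expNegInvGlue.nonneg _
    · push Not at hx
      have hy : 0 < y := hx.trans_le hxy
      simp only [expNegInvGlue, not_le.mpr hx, not_le.mpr hy, if_false]
      apply Real.exp_le_exp.mpr
      have := inv_anti₀ hx hxy
      linarith
  have heven : ∀ t, β (-t) = β t := fun t => by rw [hβ]; simp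
  have hzero : ∀ t, 1 ≤ |t| → β t = 0 := fun t ht => by
    rw [hβ]; apply expNegInvGlue.zero_of_nonpos
    have : 1 ≤ t^2 := by rw [← sq_abs]; nlinarith
    linarith
  have hanti : ∀ t u, 0 ≤ t → t ≤ u → β u ≤ β t := fun t u h0 h => by
    rw [hβ]; apply hmono; nlinarith
  have hhalf : 0 < β (1/2) := by
    rw [hβ]; exact expNegInvGlue.pos_of_pos (by norm_num)
  have hI : ∀ x y, IntervalIntegrable β MeasureTheory.volume x y := fun x y =>
    hcont.intervalIntegrable x y
  have hZ : 0 < ∫ x in (0:ℝ)..1, β x := by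
    apply intervalIntegral.intervalIntegral_pos_of_pos_on (hI 0 1) _ one_pos
    intro x hx
    rw [hβ]; exact expNegInvGlue.pos_of_pos (by nlinarith [hx.1, hx.2])
  set Z := ∫ x in (0:ℝ)..1, β x with hZd
  have hder : ∀ t, HasDerivAt (fun t => (∫ x in (0:ℝ)..t, β x) / Z) (β t / Z) t := fun t =>
    (hcont.integral_hasStrictDerivAt 0 t).hasDerivAt.div_const Z
  refine ⟨fun t => (∫ x in (0:ℝ)..t, β x) / Z, fun t => β t / Z, fun t => deriv β t / Z,
    ?_, hder, ?_, ?_, ?_, ?_, ?_, ?_, ?_, ?_⟩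
  · rw [contDiff_infty_iff_deriv]
    refine ⟨fun t => (hder t).differentiableAt, ?_⟩
    have : deriv (fun t => (∫ x in (0:ℝ)..t, β x) / Z) = fun t => β t / Z :=
      funext fun t => (hder t).deriv
    rw [this]; exact hbc.div_const Z
  · intro t
    exact ((hbc.differentiable (by simp)) t).hasDerivAt.div_const Z
  · intro t
    have : ∫ x in (0:ℝ)..(-t), β x = - ∫ x in (0:ℝ)..t, β x := by
      have h := intervalIntegral.integral_comp_neg (a := 0) (b := t) β
      simp only [heven, neg_zero] at h
      rw [h, intervalIntegral.integral_symm]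
    simp only [this]; ring
  · intro t; simp only [heven]
  · intro t ht
    have h2 : ∫ x in (1:ℝ)..t, β x = 0 := by
      rw [intervalIntegral.integral_congr (g := fun _ => (0:ℝ))]
      · simp
      · intro x hx
        rw [uIcc_of_le ht] at hx
        exact hzero x (by rw [abs_of_nonneg (by linarith [hx.1])]; exact hx.1)
    have := intervalIntegral.integral_add_adjacent_intervals (hI 0 1) (hI 1 t)
    simp only [← this, h2, add_zero]
    exact div_self hZ.ne'
  · intro t ht; simp only [hzero t ht, zero_div]
  · intro t; exact div_nonneg (hnn t) hZ.le
  · intro t u h0 h; exact div_le_div_of_nonneg_right (hanti t u h0 h) hZ.le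
  · exact div_pos hhalf hZ

lemma base_H (s s1 : ℝ → ℝ) (hs : ContDiff ℝ (⊤ : ℕ∞) s) (hd : ∀ t, HasDerivAt s (s1 t) t)
    (hodd : ∀ t, s (-t) = - s t) (h1 : ∀ t, 1 ≤ t → s t = 1) (hp : ∀ t, 0 ≤ s1 t) :
    ∃ H : ℝ → ℝ, ContDiff ℝ (⊤ : ℕ∞) H ∧ (∀ t, HasDerivAt H (s t) t) ∧ (∀ t, 0 < H t) ∧
      (∀ t, 1 ≤ |t| → H t = |t|) ∧ (∀ t, |t| ≤ 1 → H t ≤ 1) ∧ (∀ t, H t ≤ |t| + 1) ∧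
      (∀ t, s t ≤ 1) := by
  have hcont : Continuous s := hs.continuous
  have hmono : Monotone s := monotone_of_hasDerivAt_nonneg hd (by intro t; exact hp t)
  have hle : ∀ t, s t ≤ 1 := fun t => by
    rw [← h1 (max t 1) (le_max_right _ _)]; exact hmono (le_max_left _ _)
  have hder : ∀ t, HasDerivAt (fun t => 1 + ∫ x in (1:ℝ)..t, s x) (s t) t := fun t =>
    (hcont.integral_hasStrictDerivAt 1 t).hasDerivAt.const_add 1
  obtain ⟨H, hH⟩ : ∃ H : ℝ → ℝ, H = fun t => 1 + ∫ x in (1:ℝ)..t, s x := ⟨_, rfl⟩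
  rw [← hH] at hder
  have hI : ∀ x y, IntervalIntegrable s MeasureTheory.volume x y := fun x y =>
    hcont.intervalIntegrable x y
  have heven : ∀ t, H (-t) = H t := by
    have key : ∀ t, HasDerivAt (fun t => H (-t) - H t) 0 t := fun t => by
      have := ((hder (-t)).comp t (hasDerivAt_neg t)).sub (hder t)
      have e : s (-t) * -1 - s t = 0 := by rw [hodd]; ring
      rw [e] at this
      exact this
    intro t
    have := is_const_of_deriv_eq_zero (fun t => (key t).differentiableAt)
      (fun t => (key t).deriv) t 0
    simp at this; linarith
  have hge1 : ∀ t, 1 ≤ t → H t = t := by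
    intro t ht
    rw [hH]
    have : ∫ x in (1:ℝ)..t, s x = ∫ x in (1:ℝ)..t, (1:ℝ) := by
      apply intervalIntegral.integral_congr
      intro x hx
      rw [uIcc_of_le ht] at hx
      exact h1 x hx.1
    simp [this]
  have s0 : s 0 = 0 := by have := hodd 0; simp at this; linarith
  have hinc : ∀ t u, 0 ≤ t → t ≤ u → H t ≤ H u := by
    intro t u h0 h
    apply monotoneOn_of_hasDerivWithinAt_nonneg (convex_Ici 0)
      (fun x _ => (hder x).continuousAt.continuousWithinAt)
      (fun x _ => (hder x).hasDerivWithinAt) _ h0 (h0.trans h) h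
    intro x hx
    simp at hx
    rw [← s0]; exact hmono hx.le
  have hlip : Antitone (fun t => H t - t) :=
    antitone_of_hasDerivAt_nonpos (fun t => (hder t).sub (hasDerivAt_id t))
      (by intro t; simpa using hle t)
  have hpos0 : 0 < H 0 := by
    by_contra hneg
    have e1 : H 1 = 1 := hge1 1 le_rfl
    have h01 : H 0 = 0 := by
      have := hlip (zero_le_one)
      have : H 1 - 1 ≤ H 0 - 0 := this
      push Not at hneg
      linarith
    -- then `H t = t` on `[0,1]`, contradicting `H' 0 = 0`
    have hid : ∀ t, 0 ≤ t → t ≤ 1 → H t = t := by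
      intro t h0 h1'
      have a1 : H 1 - 1 ≤ H t - t := hlip h1'
      have a2 : H t - t ≤ H 0 - 0 := hlip h0
      linarith
    have hd0 : HasDerivWithinAt H (s 0) (Icc 0 1) 0 := (hder 0).hasDerivWithinAt
    have hd1 : HasDerivWithinAt H 1 (Icc 0 1) 0 :=
      (hasDerivWithinAt_id (0:ℝ) (Icc 0 1)).congr (fun x hx => hid x hx.1 hx.2) h01
    have := (uniqueDiffOn_Icc (zero_lt_one (α := ℝ)) 0 (by simp)).eq_deriv _ hd0 hd1
    rw [s0] at this; norm_num at this
  have hpos : ∀ t, 0 < H t := by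
    intro t
    rcases le_total 0 t with h | h
    · exact hpos0.trans_le (hinc 0 t le_rfl h)
    · rw [← heven]; exact hpos0.trans_le (hinc 0 (-t) le_rfl (by linarith))
  have habs : ∀ t, H t = H |t| := by
    intro t
    rcases abs_choice t with h | h <;> rw [h]
    rw [heven]
  refine ⟨H, ?_, hder, hpos, ?_, ?_, ?_, hle⟩
  · rw [contDiff_infty_iff_deriv]
    refine ⟨fun t => (hder t).differentiableAt, ?_⟩
    have : deriv H = s := funext fun t => (hder t).deriv
    rw [this]; exact hs
  · intro t ht; rw [habs]; exact hge1 _ ht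
  · intro t ht; rw [habs]
    have := hinc |t| 1 (abs_nonneg _) ht
    rwa [hge1 1 le_rfl] at this
  · intro t
    rcases le_total 1 |t| with h | h
    · rw [habs, hge1 _ h]; linarith
    · rw [habs]
      have := hinc |t| 1 (abs_nonneg _) h
      rw [hge1 1 le_rfl] at this
      linarith [abs_nonneg t]

/-- All one-variable data used in the construction: the profile `g = H`, the looped curve
`(X, Y)` whose ends are two rays through the origin, and the reparametrization `k`. -/
structure CurveData where
  s : ℝ → ℝ
  H2 : ℝ → ℝ
  H : ℝ → ℝ
  X : ℝ → ℝ
  X1 : ℝ → ℝ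
  X2 : ℝ → ℝ
  Y : ℝ → ℝ
  Y1 : ℝ → ℝ
  Y2 : ℝ → ℝ
  k : ℝ → ℝ
  k1 : ℝ → ℝ
  B : ℝ
  hB : 1 ≤ B
  H_smooth : ContDiff ℝ (⊤ : ℕ∞) H
  H_der : ∀ t, HasDerivAt H (s t) t
  s_der : ∀ t, HasDerivAt s (H2 t) t
  H2_nonneg : ∀ t, 0 ≤ H2 t
  H_pos : ∀ t, 0 < H t
  H_abs : ∀ t, 1 ≤ |t| → H t = |t|
  H_le_one : ∀ t, |t| ≤ 1 → H t ≤ 1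
  H_le : ∀ t, H t ≤ |t| + 1
  H_cone : ∀ t, 1 ≤ |t| → t * s t = H t
  X_smooth : ContDiff ℝ (⊤ : ℕ∞) X
  Y_smooth : ContDiff ℝ (⊤ : ℕ∞) Y
  k_smooth : ContDiff ℝ (⊤ : ℕ∞) k
  X_der : ∀ t, HasDerivAt X (X1 t) t
  X1_der : ∀ t, HasDerivAt X1 (X2 t) t
  Y_der : ∀ t, HasDerivAt Y (Y1 t) t
  Y1_der : ∀ t, HasDerivAt Y1 (Y2 t) t
  k_der : ∀ t, HasDerivAt k (k1 t) t
  k1_pos : ∀ t, 0 < k1 t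
  W_nonneg : ∀ t, 0 ≤ X t * Y1 t - Y t * X1 t
  V_nonneg : ∀ t, 0 ≤ X1 t * Y2 t - Y1 t * X2 t
  reg : ∀ t, X1 t ≠ 0 ∨ Y1 t ≠ 0
  W_zero : ∀ u, 1 ≤ |u| → X (k u) * Y1 (k u) - Y (k u) * X1 (k u) = 0
  X_tail : ∀ u, 1 ≤ |u| → X (k u) = -|u|
  Y_tail : ∀ u, 1 ≤ |u| → Y (k u) = -u
  X_bound : ∀ u, |X (k u)| ≤ |u| + B
  Y_bound : ∀ u, |Y (k u)| ≤ |u| + B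
  X_zero : 0 < X (k 0)
  Y_zero : Y (k 0) = 0

lemma curveData_nonempty : Nonempty CurveData := by
  obtain ⟨s, s1, s2, hs, hd, hd1, hodd, heven, h1, hz, hp, hanti, hhalf⟩ := base_sigma
  obtain ⟨H, HS, Hd, Hpos, Habs, Hone, Hle, sle⟩ := base_H s s1 hs hd hodd h1 hp
  have hmono : Monotone s := monotone_of_hasDerivAt_nonneg hd (by intro t; exact hp t)
  have s0 : s 0 = 0 := by have := hodd 0; simp at this; linarith
  obtain ⟨b, hb1, hb⟩ : ∃ b : ℝ, 1 ≤ b ∧ 1 < b * s1 (1/2) := by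
    refine ⟨1 + 1 / s1 (1/2), ?_, ?_⟩
    · have := one_div_pos.mpr hhalf; linarith
    · have : (1 + 1 / s1 (1/2)) * s1 (1/2) = s1 (1/2) + 1 := by field_simp
      rw [this]; linarith
  have b0 : 0 < b := by linarith
  have hgt : ∀ t, |t| ≤ 1/2 → 1 < b * s1 t := by
    intro t ht
    have e : s1 t = s1 |t| := by
      rcases abs_choice t with h | h <;> rw [h]
      rw [heven]
    have := hanti |t| (1/2) (abs_nonneg _) ht
    rw [e]; nlinarith
  have snn : ∀ t, 0 ≤ t → 0 ≤ s t := fun t ht => by rw [← s0]; exact hmono ht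
  have sge : ∀ t, -1 ≤ s t := fun t => by have := sle (-t); rw [hodd] at this; linarith
  have sm1 : ∀ t, t ≤ -1 → s t = -1 := fun t ht => by
    have := h1 (-t) (by linarith); rw [hodd] at this; linarith
  have s2odd : ∀ t, s2 (-t) = - s2 t := by
    intro t
    have a := (hd1 (-t)).comp t (hasDerivAt_neg t)
    have e : s1 ∘ Neg.neg = s1 := funext fun x => heven x
    rw [e] at a
    have := a.unique (hd1 t)
    linarith
  have s2neg : ∀ t, 0 ≤ t → s2 t ≤ 0 := by
    intro t ht
    have ha : AntitoneOn s1 (Ici 0) := fun x hx y _ hxy => hanti x y hx hxy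
    have := ha.derivWithin_nonpos (x := t)
    rwa [((hd1 t).hasDerivWithinAt).derivWithin (uniqueDiffOn_Ici 0 t ht)] at this
  -- concavity
  have hconc : ∀ t, 0 ≤ t → 1 - s t ≤ s1 t * (b - t) ∨ 1 ≤ t := by
    intro t ht
    rcases le_or_gt 1 t with h | h
    · right; exact h
    · left
      obtain ⟨c, hc, hcs⟩ := exists_hasDerivAt_eq_slope s s1 h
        (fun x _ => (hd x).continuousAt.continuousWithinAt) (fun x _ => hd x)
      rw [h1 1 le_rfl, eq_div_iff (by linarith)] at hcs
      have := hanti t c ht hc.1.le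
      nlinarith [hp t]
  have Wpos : ∀ t, 0 ≤ t →
      0 ≤ (b - H (2*t) / 2) * (b * s1 t - 1) - (b * s t - t) * (- s (2*t)) := by
    intro t ht
    rcases le_or_gt t (1/2) with h | h
    · have a1 := hgt t (by rw [abs_of_nonneg ht]; exact h)
      have a2 := Hone (2*t) (by rw [abs_of_nonneg (by linarith)]; linarith)
      have a3 := snn (2*t) (by linarith)
      have a4 : 0 ≤ b * s t - t := by
        -- mean value
        rcases ht.eq_or_lt with h0 | h0
        · rw [← h0, s0]; simp
        · obtain ⟨c, hc, hcs⟩ := exists_hasDerivAt_eq_slope s s1 h0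
            (fun x _ => (hd x).continuousAt.continuousWithinAt) (fun x _ => hd x)
          rw [s0, eq_div_iff (by linarith)] at hcs
          have a5 := hgt c (by rw [abs_of_nonneg hc.1.le]; linarith [hc.2])
          have : b * s t = b * s1 c * t := by
            have : s t = s1 c * t := by linarith
            rw [this]; ring
          rw [this]; nlinarith
      have a6 : 0 ≤ (b - H (2*t) / 2) * (b * s1 t - 1) :=
        mul_nonneg (by linarith) (by linarith)
      have a7 := mul_nonneg a4 a3
      linarith
    · rw [Habs (2*t) (by rw [abs_of_nonneg (by linarith)]; linarith),
        h1 (2*t) (by linarith), abs_of_nonneg (by linarith : 0 ≤ 2*t)]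
      rcases hconc t ht with h2 | h2
      · have : 0 ≤ b * (s1 t * (b - t) - (1 - s t)) := mul_nonneg b0.le (by linarith)
        nlinarith
      · rw [h1 t h2, hz t (by rw [abs_of_nonneg ht]; exact h2)]
        apply le_of_eq; ring
  have Heven : ∀ t, H (-t) = H t := by
    have key : ∀ t, HasDerivAt (fun t => H (-t) - H t) 0 t := fun t => by
      have := ((Hd (-t)).comp t (hasDerivAt_neg t)).sub (Hd t)
      have e : s (-t) * -1 - s t = 0 := by rw [hodd]; ring
      rw [e] at this
      exact this
    intro t
    have := is_const_of_deriv_eq_zero (fun t => (key t).differentiableAt)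
      (fun t => (key t).deriv) t 0
    simp at this; linarith
  have Vpos : ∀ t, 0 ≤ t →
      0 ≤ (- s (2*t)) * (b * s2 t) - (b * s1 t - 1) * (-2 * s1 (2*t)) := by
    intro t ht
    have a1 : 0 ≤ s (2*t) * (b * (- s2 t)) :=
      mul_nonneg (snn _ (by linarith)) (mul_nonneg b0.le (by linarith [s2neg t ht]))
    have a2 : 0 ≤ (b * s1 t - 1) * s1 (2*t) := by
      rcases le_or_gt t (1/2) with h | h
      · have a1 := hgt t (by rw [abs_of_nonneg ht]; exact h)
        exact mul_nonneg (by linarith) (hp _)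
      · rw [hz (2*t) (by rw [abs_of_nonneg (by linarith)]; linarith)]; simp
    nlinarith
  have ktail : ∀ u, 1 ≤ |u| → (1 ≤ u ∧ s u = 1 ∧ s (u + b * s u) = 1 ∧ s1 (u + b * s u) = 0 ∧
      s (2 * (u + b * s u)) = 1 ∧ H (2 * (u + b * s u)) = 2 * (u + b)) ∨
      (u ≤ -1 ∧ s u = -1 ∧ s (u + b * s u) = -1 ∧ s1 (u + b * s u) = 0 ∧
      s (2 * (u + b * s u)) = -1 ∧ H (2 * (u + b * s u)) = 2 * (-u + b)) := by
    intro u hu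
    rcases le_abs'.mp hu with h | h
    · right
      rw [sm1 u h]
      refine ⟨h, rfl, sm1 _ (by linarith), hz _ ?_, sm1 _ (by linarith), ?_⟩
      · rw [abs_of_neg (by linarith)]; linarith
      · rw [Habs, abs_of_neg (by linarith)]
        · ring
        · rw [abs_of_neg (by linarith)]; linarith
    · left
      rw [h1 u h]
      refine ⟨h, rfl, h1 _ (by linarith), hz _ ?_, h1 _ (by linarith), ?_⟩
      · rw [abs_of_pos (by linarith)]; linarith
      · rw [Habs, abs_of_pos (by linarith)]
        · ring
        · rw [abs_of_pos (by linarith)]; linarith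
  have sabs : ∀ t, |s t| ≤ 1 := fun t => abs_le.mpr ⟨sge t, sle t⟩
  have kb : ∀ u, |u + b * s u| ≤ |u| + b := fun u => by
    calc |u + b * s u| ≤ |u| + |b * s u| := abs_add_le _ _
      _ ≤ |u| + b := by
        rw [abs_mul, abs_of_pos b0]; nlinarith [sabs u]
  exact ⟨{
    s := s
    H2 := s1
    H := H
    X := fun t => b - H (2*t) / 2
    X1 := fun t => - s (2*t)
    X2 := fun t => -2 * s1 (2*t)
    Y := fun t => b * s t - t
    Y1 := fun t => b * s1 t - 1
    Y2 := fun t => b * s2 t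
    k := fun t => t + b * s t
    k1 := fun t => 1 + b * s1 t
    B := 2 * b + 1
    hB := by linarith
    H_smooth := HS
    H_der := Hd
    s_der := hd
    H2_nonneg := hp
    H_pos := Hpos
    H_abs := Habs
    H_le_one := Hone
    H_le := Hle
    H_cone := by
      intro t ht
      rw [Habs t ht]
      rcases le_abs'.mp ht with h | h
      · rw [sm1 t h, abs_of_neg (by linarith)]; ring
      · rw [h1 t h, abs_of_pos (by linarith)]; ring
    X_smooth := by
      exact contDiff_const.sub ((HS.comp (contDiff_const.mul contDiff_id)).div_const 2)
    Y_smooth := (contDiff_const.mul hs).sub contDiff_id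
    k_smooth := contDiff_id.add (contDiff_const.mul hs)
    X_der := by
      intro t
      have := (((Hd (2*t)).comp t ((hasDerivAt_id t).const_mul 2)).div_const 2).const_sub b
      exact this.congr_deriv (by simp)
    X1_der := by
      intro t
      have := ((hd (2*t)).comp t ((hasDerivAt_id t).const_mul 2)).neg
      exact this.congr_deriv (by simp; ring)
    Y_der := fun t => ((hd t).const_mul b).sub (hasDerivAt_id t)
    Y1_der := fun t => ((hd1 t).const_mul b).sub_const 1
    k_der := fun t => (hasDerivAt_id t).add ((hd t).const_mul b)
    k1_pos := fun t => by have := mul_nonneg b0.le (hp t); linarith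
    W_nonneg := by
      intro t
      rcases le_total 0 t with h | h
      · exact Wpos t h
      · have := Wpos (-t) (by linarith)
        rw [mul_neg, Heven, heven, hodd, hodd] at this
        linarith
    V_nonneg := by
      intro t
      rcases le_total 0 t with h | h
      · exact Vpos t h
      · have := Vpos (-t) (by linarith)
        rw [mul_neg 2 t, heven, heven, hodd, s2odd] at this
        linarith
    reg := by
      intro t
      rcases le_or_gt |t| (1/2) with h | h
      · right; have := hgt t h; linarith
      · left
        rcases lt_abs.mp h with h | h
        · rw [h1 (2*t) (by linarith)]; norm_num
        · rw [sm1 (2*t) (by linarith)]; norm_num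
    W_zero := by
      intro u hu
      rcases ktail u hu with ⟨_, e1, e2, e3, e4, e5⟩ | ⟨_, e1, e2, e3, e4, e5⟩ <;>
      · simp only [e2, e3, e4, e5]; rw [e1]; ring
    X_tail := by
      intro u hu
      rcases ktail u hu with ⟨h, e1, e2, e3, e4, e5⟩ | ⟨h, e1, e2, e3, e4, e5⟩
      · simp only [e5]; rw [abs_of_pos (by linarith)]; ring
      · simp only [e5]; rw [abs_of_neg (by linarith)]; ring
    Y_tail := by
      intro u hu
      rcases ktail u hu with ⟨h, e1, e2, e3, e4, e5⟩ | ⟨h, e1, e2, e3, e4, e5⟩ <;>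
      · simp only [e2]; rw [e1]; ring
    X_bound := by
      intro u
      have a := Hle (2 * (u + b * s u))
      have p := Hpos (2 * (u + b * s u))
      rw [abs_mul, abs_of_pos (two_pos : (0:ℝ) < 2)] at a
      have c := kb u
      have d := abs_nonneg u
      rw [abs_le]
      constructor <;> linarith
    Y_bound := by
      intro u
      have c := abs_le.mp (kb u)
      have d := abs_le.mp (sabs (u + b * s u))
      rw [abs_le]
      constructor <;> nlinarith
    X_zero := by
      have := Hone 0 (by simp)
      simp only [s0, mul_zero, add_zero]; linarith
    Y_zero := by simp [s0] }⟩

/-- scalar partial derivatives -/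
def dx (f : ℝ × ℝ → ℝ) (p : ℝ × ℝ) : ℝ := deriv (fun s => f (s, p.2)) p.1
def dy (f : ℝ × ℝ → ℝ) (p : ℝ × ℝ) : ℝ := deriv (fun s => f (p.1, s)) p.2

lemma slice_x (p : ℝ × ℝ) (f : ℝ × ℝ → ℝ) (hf : ContDiff ℝ (⊤ : ℕ∞) f) :
    HasDerivAt (fun s => f (s, p.2)) (fderiv ℝ f p (1, 0)) p.1 := by
  have h1 : HasFDerivAt f (fderiv ℝ f p) (p.1, p.2) :=
    ((hf.differentiable (by simp)) p).hasFDerivAt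
  have h2 : HasDerivAt (fun s : ℝ => (s, p.2)) ((1:ℝ), (0:ℝ)) p.1 :=
    (hasDerivAt_id p.1).prodMk (hasDerivAt_const p.1 p.2)
  exact h1.comp_hasDerivAt p.1 h2

lemma slice_y (p : ℝ × ℝ) (f : ℝ × ℝ → ℝ) (hf : ContDiff ℝ (⊤ : ℕ∞) f) :
    HasDerivAt (fun s => f (p.1, s)) (fderiv ℝ f p (0, 1)) p.2 := by
  have h1 : HasFDerivAt f (fderiv ℝ f p) (p.1, p.2) :=
    ((hf.differentiable (by simp)) p).hasFDerivAt
  have h2 : HasDerivAt (fun s : ℝ => (p.1, s)) ((0:ℝ), (1:ℝ)) p.2 :=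
    (hasDerivAt_const p.2 p.1).prodMk (hasDerivAt_id p.2)
  exact h1.comp_hasDerivAt p.2 h2

lemma dx_eq (f : ℝ × ℝ → ℝ) (hf : ContDiff ℝ (⊤ : ℕ∞) f) :
    dx f = fun p => fderiv ℝ f p (1, 0) := funext fun p => (slice_x p f hf).deriv

lemma dy_eq (f : ℝ × ℝ → ℝ) (hf : ContDiff ℝ (⊤ : ℕ∞) f) :
    dy f = fun p => fderiv ℝ f p (0, 1) := funext fun p => (slice_y p f hf).deriv

lemma has_dx (f : ℝ × ℝ → ℝ) (hf : ContDiff ℝ (⊤ : ℕ∞) f) (x y : ℝ) :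
    HasDerivAt (fun s => f (s, y)) (dx f (x, y)) x := by
  rw [dx_eq f hf]; exact slice_x (x, y) f hf

lemma has_dy (f : ℝ × ℝ → ℝ) (hf : ContDiff ℝ (⊤ : ℕ∞) f) (x y : ℝ) :
    HasDerivAt (fun s => f (x, s)) (dy f (x, y)) y := by
  rw [dy_eq f hf]; exact slice_y (x, y) f hf

lemma dx_smooth (f : ℝ × ℝ → ℝ) (hf : ContDiff ℝ (⊤ : ℕ∞) f) : ContDiff ℝ (⊤ : ℕ∞) (dx f) := by
  rw [dx_eq f hf]
  exact (contDiff_infty_iff_fderiv.mp hf).2.clm_apply contDiff_const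

lemma dy_smooth (f : ℝ × ℝ → ℝ) (hf : ContDiff ℝ (⊤ : ℕ∞) f) : ContDiff ℝ (⊤ : ℕ∞) (dy f) := by
  rw [dy_eq f hf]
  exact (contDiff_infty_iff_fderiv.mp hf).2.clm_apply contDiff_const

/-- one-variable: first derivative of `g(A) X(c)` -/
lemma prod_der {g g1 X X1 A c : ℝ → ℝ} {A' c' t : ℝ}
    (hg : ∀ t, HasDerivAt g (g1 t) t) (hX : ∀ t, HasDerivAt X (X1 t) t)
    (hA : HasDerivAt A A' t) (hc : HasDerivAt c c' t) :
    HasDerivAt (fun t => g (A t) * X (c t))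
      (g1 (A t) * A' * X (c t) + g (A t) * (X1 (c t) * c')) t :=
  ((hg (A t)).comp t hA).mul ((hX (c t)).comp t hc)

/-- one-variable: mixed second derivative of `g(A) X(c)` -/
lemma prod_der2 {g g1 g2 X X1 X2 A c E F : ℝ → ℝ} {A' c' E' F' t : ℝ}
    (hg : ∀ t, HasDerivAt g (g1 t) t) (hX : ∀ t, HasDerivAt X (X1 t) t)
    (hg1 : ∀ t, HasDerivAt g1 (g2 t) t) (hX1 : ∀ t, HasDerivAt X1 (X2 t) t)
    (hA : HasDerivAt A A' t) (hc : HasDerivAt c c' t)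
    (hE : HasDerivAt E E' t) (hF : HasDerivAt F F' t) :
    HasDerivAt (fun t => g1 (A t) * E t * X (c t) + g (A t) * (X1 (c t) * F t))
      (g2 (A t) * A' * E t * X (c t) + g1 (A t) * E' * X (c t)
        + g1 (A t) * E t * (X1 (c t) * c') + g1 (A t) * A' * (X1 (c t) * F t)
        + g (A t) * (X2 (c t) * c' * F t) + g (A t) * (X1 (c t) * F')) t := by
  have h := (((hg1 (A t)).comp t hA).mul hE).mul ((hX (c t)).comp t hc)
  have h' := ((hg (A t)).comp t hA).mul (((hX1 (c t)).comp t hc).mul hF)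
  refine (h.add h').congr_deriv ?_
  simp only [Function.comp, Pi.mul_apply]; ring

section Geom
variable {A c : ℝ × ℝ → ℝ} {g g1 g2 X X1 X2 Y Y1 Y2 : ℝ → ℝ}

/-- the explicit surface patch -/
def patch (A c : ℝ × ℝ → ℝ) (g X Y : ℝ → ℝ) (p : ℝ × ℝ) : ℝ × ℝ × ℝ :=
  (A p, g (A p) * X (c p), g (A p) * Y (c p))

def d1 (A c : ℝ × ℝ → ℝ) (g g1 X X1 : ℝ → ℝ) (E F : ℝ × ℝ → ℝ) (p : ℝ × ℝ) : ℝ :=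
  g1 (A p) * E p * X (c p) + g (A p) * (X1 (c p) * F p)

def d2 (A c : ℝ × ℝ → ℝ) (g g1 g2 X X1 X2 : ℝ → ℝ) (Ax cx Ay cy Axy cxy : ℝ × ℝ → ℝ)
    (p : ℝ × ℝ) : ℝ :=
  g2 (A p) * Ay p * Ax p * X (c p) + g1 (A p) * Axy p * X (c p)
        + g1 (A p) * Ax p * (X1 (c p) * cy p) + g1 (A p) * Ay p * (X1 (c p) * cx p)
        + g (A p) * (X2 (c p) * cy p * cx p) + g (A p) * (X1 (c p) * cxy p)

lemma patch_x (hA : ContDiff ℝ (⊤ : ℕ∞) A) (hc : ContDiff ℝ (⊤ : ℕ∞) c)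
    (hg : ∀ t, HasDerivAt g (g1 t) t) (hX : ∀ t, HasDerivAt X (X1 t) t)
    (hY : ∀ t, HasDerivAt Y (Y1 t) t) :
    pderivX (patch A c g X Y) = fun p =>
      (dx A p, d1 A c g g1 X X1 (dx A) (dx c) p, d1 A c g g1 Y Y1 (dx A) (dx c) p) := by
  funext ⟨x, y⟩
  exact ((has_dx A hA x y).prodMk ((prod_der hg hX (has_dx A hA x y) (has_dx c hc x y)).prodMk
    (prod_der hg hY (has_dx A hA x y) (has_dx c hc x y)))).deriv

lemma patch_y (hA : ContDiff ℝ (⊤ : ℕ∞) A) (hc : ContDiff ℝ (⊤ : ℕ∞) c)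
    (hg : ∀ t, HasDerivAt g (g1 t) t) (hX : ∀ t, HasDerivAt X (X1 t) t)
    (hY : ∀ t, HasDerivAt Y (Y1 t) t) :
    pderivY (patch A c g X Y) = fun p =>
      (dy A p, d1 A c g g1 X X1 (dy A) (dy c) p, d1 A c g g1 Y Y1 (dy A) (dy c) p) := by
  funext ⟨x, y⟩
  exact ((has_dy A hA x y).prodMk ((prod_der hg hX (has_dy A hA x y) (has_dy c hc x y)).prodMk
    (prod_der hg hY (has_dy A hA x y) (has_dy c hc x y)))).deriv

lemma patch_xx (hA : ContDiff ℝ (⊤ : ℕ∞) A) (hc : ContDiff ℝ (⊤ : ℕ∞) c)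
    (hg : ∀ t, HasDerivAt g (g1 t) t) (hX : ∀ t, HasDerivAt X (X1 t) t)
    (hY : ∀ t, HasDerivAt Y (Y1 t) t) (hg1 : ∀ t, HasDerivAt g1 (g2 t) t)
    (hX1 : ∀ t, HasDerivAt X1 (X2 t) t) (hY1 : ∀ t, HasDerivAt Y1 (Y2 t) t) (p : ℝ × ℝ) :
    pderivXX (patch A c g X Y) p =
      (dx (dx A) p,
       d2 A c g g1 g2 X X1 X2 (dx A) (dx c) (dx A) (dx c) (dx (dx A)) (dx (dx c)) p,
       d2 A c g g1 g2 Y Y1 Y2 (dx A) (dx c) (dx A) (dx c) (dx (dx A)) (dx (dx c)) p) := by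
  obtain ⟨x, y⟩ := p
  unfold pderivXX
  rw [patch_x hA hc hg hX hY]
  have a1 := has_dx A hA x y
  have a2 := has_dx c hc x y
  have a3 := has_dx _ (dx_smooth A hA) x y
  have a4 := has_dx _ (dx_smooth c hc) x y
  exact (a3.prodMk ((prod_der2 hg hX hg1 hX1 a1 a2 a3 a4).prodMk
    (prod_der2 hg hY hg1 hY1 a1 a2 a3 a4))).deriv

lemma patch_xy (hA : ContDiff ℝ (⊤ : ℕ∞) A) (hc : ContDiff ℝ (⊤ : ℕ∞) c)
    (hg : ∀ t, HasDerivAt g (g1 t) t) (hX : ∀ t, HasDerivAt X (X1 t) t)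
    (hY : ∀ t, HasDerivAt Y (Y1 t) t) (hg1 : ∀ t, HasDerivAt g1 (g2 t) t)
    (hX1 : ∀ t, HasDerivAt X1 (X2 t) t) (hY1 : ∀ t, HasDerivAt Y1 (Y2 t) t) (p : ℝ × ℝ) :
    pderivXY (patch A c g X Y) p =
      (dy (dx A) p,
       d2 A c g g1 g2 X X1 X2 (dx A) (dx c) (dy A) (dy c) (dy (dx A)) (dy (dx c)) p,
       d2 A c g g1 g2 Y Y1 Y2 (dx A) (dx c) (dy A) (dy c) (dy (dx A)) (dy (dx c)) p) := by
  obtain ⟨x, y⟩ := p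
  unfold pderivXY
  rw [patch_x hA hc hg hX hY]
  have a1 := has_dy A hA x y
  have a2 := has_dy c hc x y
  have a3 := has_dy _ (dx_smooth A hA) x y
  have a4 := has_dy _ (dx_smooth c hc) x y
  exact (a3.prodMk ((prod_der2 hg hX hg1 hX1 a1 a2 a3 a4).prodMk
    (prod_der2 hg hY hg1 hY1 a1 a2 a3 a4))).deriv

lemma patch_yy (hA : ContDiff ℝ (⊤ : ℕ∞) A) (hc : ContDiff ℝ (⊤ : ℕ∞) c)
    (hg : ∀ t, HasDerivAt g (g1 t) t) (hX : ∀ t, HasDerivAt X (X1 t) t)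
    (hY : ∀ t, HasDerivAt Y (Y1 t) t) (hg1 : ∀ t, HasDerivAt g1 (g2 t) t)
    (hX1 : ∀ t, HasDerivAt X1 (X2 t) t) (hY1 : ∀ t, HasDerivAt Y1 (Y2 t) t) (p : ℝ × ℝ) :
    pderivYY (patch A c g X Y) p =
      (dy (dy A) p,
       d2 A c g g1 g2 X X1 X2 (dy A) (dy c) (dy A) (dy c) (dy (dy A)) (dy (dy c)) p,
       d2 A c g g1 g2 Y Y1 Y2 (dy A) (dy c) (dy A) (dy c) (dy (dy A)) (dy (dy c)) p) := by
  obtain ⟨x, y⟩ := p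
  unfold pderivYY
  rw [patch_y hA hc hg hX hY]
  have a1 := has_dy A hA x y
  have a2 := has_dy c hc x y
  have a3 := has_dy _ (dy_smooth A hA) x y
  have a4 := has_dy _ (dy_smooth c hc) x y
  exact (a3.prodMk ((prod_der2 hg hX hg1 hX1 a1 a2 a3 a4).prodMk
    (prod_der2 hg hY hg1 hY1 a1 a2 a3 a4))).deriv

/-- the normal vector of the patch -/
lemma patch_normal (hA : ContDiff ℝ (⊤ : ℕ∞) A) (hc : ContDiff ℝ (⊤ : ℕ∞) c)
    (hg : ∀ t, HasDerivAt g (g1 t) t) (hX : ∀ t, HasDerivAt X (X1 t) t)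
    (hY : ∀ t, HasDerivAt Y (Y1 t) t) (p : ℝ × ℝ) :
    cross3 (pderivX (patch A c g X Y) p) (pderivY (patch A c g X Y) p) =
      ((dx A p * dy c p - dy A p * dx c p) *
          (g1 (A p) * g (A p) * (X (c p) * Y1 (c p) - Y (c p) * X1 (c p))),
       (dx A p * dy c p - dy A p * dx c p) * (- (g (A p) * Y1 (c p))),
       (dx A p * dy c p - dy A p * dx c p) * (g (A p) * X1 (c p))) := by
  rw [patch_x hA hc hg hX hY, patch_y hA hc hg hX hY]
  simp only [cross3, d1, Prod.mk.injEq]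
  refine ⟨?_, ?_, ?_⟩ <;> ring

lemma patch_saddle (hA : ContDiff ℝ (⊤ : ℕ∞) A) (hc : ContDiff ℝ (⊤ : ℕ∞) c)
    (hg : ∀ t, HasDerivAt g (g1 t) t) (hX : ∀ t, HasDerivAt X (X1 t) t)
    (hY : ∀ t, HasDerivAt Y (Y1 t) t) (hg1 : ∀ t, HasDerivAt g1 (g2 t) t)
    (hX1 : ∀ t, HasDerivAt X1 (X2 t) t) (hY1 : ∀ t, HasDerivAt Y1 (Y2 t) t)
    (gpos : ∀ t, 0 < g t) (g2nn : ∀ t, 0 ≤ g2 t)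
    (W : ∀ t, 0 ≤ X t * Y1 t - Y t * X1 t) (V : ∀ t, 0 ≤ X1 t * Y2 t - Y1 t * X2 t)
    (p : ℝ × ℝ) :
    dot3 (pderivXX (patch A c g X Y) p)
        (cross3 (pderivX (patch A c g X Y) p) (pderivY (patch A c g X Y) p)) *
      dot3 (pderivYY (patch A c g X Y) p)
        (cross3 (pderivX (patch A c g X Y) p) (pderivY (patch A c g X Y) p)) -
      dot3 (pderivXY (patch A c g X Y) p)
        (cross3 (pderivX (patch A c g X Y) p) (pderivY (patch A c g X Y) p)) ^ 2 ≤ 0 := by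
  rw [patch_normal hA hc hg hX hY, patch_xx hA hc hg hX hY hg1 hX1 hY1,
    patch_xy hA hc hg hX hY hg1 hX1 hY1, patch_yy hA hc hg hX hY hg1 hX1 hY1]
  have hW := W (c p)
  have hV := V (c p)
  have hG := gpos (A p)
  have hG2 := g2nn (A p)
  simp only [dot3, d2]
  generalize g (A p) = G at *
  generalize g1 (A p) = G1 at *
  generalize g2 (A p) = G2 at *
  generalize X (c p) = x at *
  generalize X1 (c p) = x1 at *
  generalize X2 (c p) = x2 at *
  generalize Y (c p) = y at *
  generalize Y1 (c p) = y1 at *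
  generalize Y2 (c p) = y2 at *
  generalize dx A p = Ax at *
  generalize dy A p = Ay at *
  generalize dx c p = cx at *
  generalize dy c p = cy at *
  generalize dx (dx A) p = Axx at *
  generalize dy (dx A) p = Axy at *
  generalize dy (dy A) p = Ayy at *
  generalize dx (dx c) p = cxx at *
  generalize dy (dx c) p = cxy at *
  generalize dy (dy c) p = cyy at *
  have key : ∀ Ax' cx' Ay' cy' Axy' cxy' D : ℝ,
      Axy' * (D * (G1 * G * (x * y1 - y * x1))) +
        (G2 * Ay' * Ax' * x + G1 * Axy' * x + G1 * Ax' * (x1 * cy') + G1 * Ay' * (x1 * cx')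
          + G * (x2 * cy' * cx') + G * (x1 * cxy')) * (D * -(G * y1)) +
        (G2 * Ay' * Ax' * y + G1 * Axy' * y + G1 * Ax' * (y1 * cy') + G1 * Ay' * (y1 * cx')
          + G * (y2 * cy' * cx') + G * (y1 * cxy')) * (D * (G * x1)) =
      D * G * (G * (x1 * y2 - y1 * x2) * (cx' * cy') - G2 * (x * y1 - y * x1) * (Ax' * Ay')) := by
    intros; ring
  rw [key, key, key]
  have h0 : 0 ≤ (Ax * cy - Ay * cx)^2 * (Ax * cy - Ay * cx)^2 * G^2 *
      (G * (x1 * y2 - y1 * x2) * (G2 * (x * y1 - y * x1))) := by positivity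
  nlinarith [h0]

lemma patch_immersion (hA : ContDiff ℝ (⊤ : ℕ∞) A) (hc : ContDiff ℝ (⊤ : ℕ∞) c)
    (hg : ∀ t, HasDerivAt g (g1 t) t) (hX : ∀ t, HasDerivAt X (X1 t) t)
    (hY : ∀ t, HasDerivAt Y (Y1 t) t) (gpos : ∀ t, 0 < g t)
    (reg : ∀ t, X1 t ≠ 0 ∨ Y1 t ≠ 0) (p : ℝ × ℝ)
    (hD : dx A p * dy c p - dy A p * dx c p ≠ 0) :
    LinearIndependent ℝ ![pderivX (patch A c g X Y) p, pderivY (patch A c g X Y) p] := by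
  have hn := patch_normal hA hc hg hX hY p
  rw [LinearIndependent.pair_iff]
  intro u v huv
  generalize pderivX (patch A c g X Y) p = P at *
  generalize pderivY (patch A c g X Y) p = Q at *
  obtain ⟨P1, P2, P3⟩ := P
  obtain ⟨Q1, Q2, Q3⟩ := Q
  simp only [cross3, Prod.mk.injEq] at hn
  obtain ⟨-, n2, n3⟩ := hn
  simp only [Prod.smul_mk, Prod.mk_add_mk, smul_eq_mul, Prod.mk_eq_zero] at huv
  obtain ⟨e1, e2, e3⟩ := huv
  have hG := (gpos (A p)).ne'
  rcases reg (c p) with h | h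
  · have hne : P1 * Q2 - P2 * Q1 ≠ 0 := by
      rw [n3]; exact mul_ne_zero hD (mul_ne_zero hG h)
    constructor
    · have : u * (P1 * Q2 - P2 * Q1) = 0 := by linear_combination Q2 * e1 - Q1 * e2
      exact (mul_eq_zero.mp this).resolve_right hne
    · have : v * (P1 * Q2 - P2 * Q1) = 0 := by linear_combination P1 * e2 - P2 * e1
      exact (mul_eq_zero.mp this).resolve_right hne
  · have hne : P3 * Q1 - P1 * Q3 ≠ 0 := by
      rw [n2]; exact mul_ne_zero hD (neg_ne_zero.mpr (mul_ne_zero hG h))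
    constructor
    · have : u * (P3 * Q1 - P1 * Q3) = 0 := by linear_combination Q1 * e3 - Q3 * e1
      exact (mul_eq_zero.mp this).resolve_right hne
    · have : v * (P3 * Q1 - P1 * Q3) = 0 := by linear_combination P3 * e1 - P1 * e3
      exact (mul_eq_zero.mp this).resolve_right hne

lemma patch_free (hA : ContDiff ℝ (⊤ : ℕ∞) A) (hc : ContDiff ℝ (⊤ : ℕ∞) c)
    (hg : ∀ t, HasDerivAt g (g1 t) t) (hX : ∀ t, HasDerivAt X (X1 t) t)
    (hY : ∀ t, HasDerivAt Y (Y1 t) t) (p : ℝ × ℝ)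
    (h : A p * g1 (A p) = g (A p) ∨ X (c p) * Y1 (c p) - Y (c p) * X1 (c p) = 0) :
    dot3 (patch A c g X Y p)
      (cross3 (pderivX (patch A c g X Y) p) (pderivY (patch A c g X Y) p)) = 0 := by
  rw [patch_normal hA hc hg hX hY]
  have : dot3 (patch A c g X Y p) ((dx A p * dy c p - dy A p * dx c p) *
          (g1 (A p) * g (A p) * (X (c p) * Y1 (c p) - Y (c p) * X1 (c p))),
       (dx A p * dy c p - dy A p * dx c p) * (- (g (A p) * Y1 (c p))),
       (dx A p * dy c p - dy A p * dx c p) * (g (A p) * X1 (c p))) =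
      (dx A p * dy c p - dy A p * dx c p) * g (A p) * (A p * g1 (A p) - g (A p)) *
        (X (c p) * Y1 (c p) - Y (c p) * X1 (c p)) := by
    simp only [dot3, patch]; ring
  rw [this]
  rcases h with h | h
  · rw [h]; ring
  · rw [h]; ring

end Geom

section Surface
variable (d : CurveData) (m : ℝ)

def Kc : ℝ := 1 + 3 * (1 + m ^ 2) * d.B ^ 2
def ac : ℝ := 1 / √(8 * Kc d m)
def gg (x : ℝ) : ℝ := ac d m * d.H (x / ac d m)
def Nn (p : ℝ × ℝ) : ℝ := p.1 ^ 2 + (gg d m p.1 * d.X (d.k (p.2 / gg d m p.1))) ^ 2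
  + (gg d m p.1 * (m * d.Y (d.k (p.2 / gg d m p.1)))) ^ 2
def inU (p : ℝ × ℝ) : Prop := ac d m ≤ |p.1| ∨ ac d m ≤ |p.2|
def rsq (p : ℝ × ℝ) : ℝ := p.1 ^ 2 + p.2 ^ 2
def chi (p : ℝ × ℝ) : ℝ := Real.smoothTransition (2 * rsq p - 1)
def EE (p : ℝ × ℝ) : ℝ := 2 * Kc d m - chi p * (2 * Kc d m - Nn d m p / rsq p)
def lam (p : ℝ × ℝ) : ℝ := 1 / √(EE d m p)
def AA (p : ℝ × ℝ) : ℝ := lam d m p * p.1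
def cc (p : ℝ × ℝ) : ℝ := d.k (lam d m p * p.2 / gg d m (AA d m p))
def psi : ℝ × ℝ → ℝ × ℝ × ℝ := patch (AA d m) (cc d m) (gg d m) d.X (fun t => m * d.Y t)

lemma Kc_ge : 4 ≤ Kc d m := by
  have h := d.hB
  have : 1 ≤ (1 + m ^ 2) * d.B ^ 2 := by nlinarith [sq_nonneg (m * d.B), sq_nonneg m]
  unfold Kc; linarith

lemma Kc_pos : 0 < Kc d m := by linarith [Kc_ge d m]

lemma ac_pos : 0 < ac d m := by
  have := Kc_pos d m
  unfold ac; positivity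

lemma ac_sq : 8 * Kc d m * ac d m ^ 2 = 1 := by
  have h := Kc_pos d m
  unfold ac
  rw [div_pow, Real.sq_sqrt (by positivity)]
  field_simp

lemma gg_pos (x : ℝ) : 0 < gg d m x := mul_pos (ac_pos d m) (d.H_pos _)

lemma gg_abs (x : ℝ) (h : ac d m ≤ |x|) : gg d m x = |x| := by
  have ha := ac_pos d m
  have e : |x / ac d m| = |x| / ac d m := by rw [abs_div, abs_of_pos ha]
  unfold gg
  rw [d.H_abs _ (by rw [e, le_div_iff₀ ha]; linarith), e]
  field_simp

lemma gg_le (x : ℝ) (h : |x| ≤ ac d m) : gg d m x ≤ ac d m := by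
  have ha := ac_pos d m
  have e : |x / ac d m| = |x| / ac d m := by rw [abs_div, abs_of_pos ha]
  have := d.H_le_one (x / ac d m) (by rw [e, div_le_iff₀ ha]; linarith)
  unfold gg; nlinarith

lemma gg_le' (x : ℝ) : gg d m x ≤ |x| + ac d m := by
  rcases le_total (ac d m) |x| with h | h
  · rw [gg_abs d m x h]; linarith [ac_pos d m]
  · linarith [gg_le d m x h, abs_nonneg x]

lemma gg_der (x : ℝ) : HasDerivAt (gg d m) (d.s (x / ac d m)) x := by
  have ha := (ac_pos d m).ne'
  have h := ((d.H_der (x / ac d m)).comp x ((hasDerivAt_id x).div_const (ac d m))).const_mul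
    (ac d m)
  refine h.congr_deriv ?_
  field_simp

lemma g1_der (x : ℝ) :
    HasDerivAt (fun x => d.s (x / ac d m)) (d.H2 (x / ac d m) / ac d m) x := by
  have h := (d.s_der (x / ac d m)).comp x ((hasDerivAt_id x).div_const (ac d m))
  refine h.congr_deriv ?_
  ring

lemma gg_smooth : ContDiff ℝ (⊤ : ℕ∞) (gg d m) := by
  unfold gg
  exact contDiff_const.mul (d.H_smooth.comp (contDiff_id.div_const _))

lemma gg_cone (x : ℝ) (h : ac d m ≤ |x|) : x * d.s (x / ac d m) = gg d m x := by
  have ha := ac_pos d m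
  have e : |x / ac d m| = |x| / ac d m := by rw [abs_div, abs_of_pos ha]
  have := d.H_cone (x / ac d m) (by rw [e, le_div_iff₀ ha]; linarith)
  unfold gg
  rw [← this]; field_simp

lemma tail_ge (x y : ℝ) (h : ¬ ac d m ≤ |x|) (h' : ac d m ≤ |y|) : 1 ≤ |y / gg d m x| := by
  have hg := gg_pos d m x
  rw [abs_div, abs_of_pos hg, le_div_iff₀ hg]
  have := gg_le d m x (by linarith)
  linarith

lemma Nn_tail (x y : ℝ) (h : 1 ≤ |y / gg d m x|) :
    Nn d m (x, y) = x ^ 2 + (1 + m ^ 2) * y ^ 2 := by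
  have hg := gg_pos d m x
  unfold Nn
  simp only
  rw [d.X_tail _ h, d.Y_tail _ h, mul_pow, neg_sq, sq_abs]
  field_simp
  ring

lemma Nn_cone (x y : ℝ) (h : ac d m ≤ |x|) :
    Nn d m (x, y) = x ^ 2 + x ^ 2 * (d.X (d.k (y / |x|)) ^ 2 + m ^ 2 * d.Y (d.k (y / |x|)) ^ 2) := by
  unfold Nn
  simp only
  rw [gg_abs d m x h, mul_pow, mul_pow, sq_abs]
  ring

lemma inU_smul (p : ℝ × ℝ) (s : ℝ) (hs : 1 ≤ s) (h : inU d m p) :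
    inU d m (s * p.1, s * p.2) := by
  have hs0 : |s| = s := abs_of_pos (by linarith)
  unfold inU at *
  simp only [abs_mul, hs0]
  rcases h with h | h
  · left; nlinarith [abs_nonneg p.1]
  · right; nlinarith [abs_nonneg p.2]

lemma Nn_smul (p : ℝ × ℝ) (s : ℝ) (hs : 1 ≤ s) (h : inU d m p) :
    Nn d m (s * p.1, s * p.2) = s ^ 2 * Nn d m p := by
  obtain ⟨x, y⟩ := p
  have hs0 : |s| = s := abs_of_pos (by linarith)
  have ha := ac_pos d m
  by_cases hx : ac d m ≤ |x|
  · have hx' : ac d m ≤ |s * x| := by rw [abs_mul, hs0]; nlinarith [abs_nonneg x]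
    simp only
    rw [Nn_cone d m _ _ hx', Nn_cone d m _ _ hx, abs_mul, hs0,
      mul_div_mul_left _ _ (by linarith : s ≠ 0)]
    ring
  · have hy : ac d m ≤ |y| := h.resolve_left hx
    have h1 := tail_ge d m x y hx hy
    have h2 : 1 ≤ |s * y / gg d m (s * x)| := by
      have hg := gg_pos d m (s * x)
      rw [abs_div, abs_of_pos hg, le_div_iff₀ hg, one_mul, abs_mul, hs0]
      rcases le_total (ac d m) |s * x| with h | h
      · rw [gg_abs d m _ h, abs_mul, hs0]
        push Not at hx
        nlinarith
      · have := gg_le d m _ h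
        nlinarith
    simp only
    rw [Nn_tail d m _ _ h1, Nn_tail d m _ _ h2]; ring

lemma Nn_pos (p : ℝ × ℝ) (h : inU d m p) : 0 < Nn d m p := by
  obtain ⟨x, y⟩ := p
  have ha := ac_pos d m
  by_cases hx : ac d m ≤ |x|
  · have : x ≠ 0 := abs_pos.mp (by linarith)
    unfold Nn; positivity
  · have hy : ac d m ≤ |y| := h.resolve_left hx
    have : y ≠ 0 := abs_pos.mp (by linarith)
    rw [Nn_tail d m _ _ (tail_ge d m x y hx hy)]
    positivity

lemma Nn_le (p : ℝ × ℝ) : Nn d m p ≤ Kc d m * (rsq p + ac d m ^ 2) := by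
  obtain ⟨x, y⟩ := p
  have hg := gg_pos d m x
  have hB := d.hB
  have ha := ac_pos d m
  have hgl := gg_le' d m x
  have key : ∀ Z : ℝ, |Z| ≤ |y / gg d m x| + d.B →
      (gg d m x * Z) ^ 2 ≤ 3 * d.B ^ 2 * (x ^ 2 + y ^ 2 + ac d m ^ 2) := by
    intro Z hZ
    have h1 : |gg d m x * Z| ≤ |y| + d.B * (|x| + ac d m) := by
      rw [abs_mul, abs_of_pos hg]
      calc gg d m x * |Z| ≤ gg d m x * (|y / gg d m x| + d.B) := by gcongr
        _ = |y| + d.B * gg d m x := by rw [abs_div, abs_of_pos hg]; field_simp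
        _ ≤ _ := by gcongr
    have h2 : (gg d m x * Z) ^ 2 ≤ (|y| + d.B * (|x| + ac d m)) ^ 2 := by
      rw [← sq_abs]; gcongr
    have h3 : |y| + d.B * (|x| + ac d m) ≤ d.B * (|y| + |x| + ac d m) := by
      nlinarith [abs_nonneg y]
    have h4 : (|y| + d.B * (|x| + ac d m)) ^ 2 ≤ (d.B * (|y| + |x| + ac d m)) ^ 2 := by
      gcongr
    have h5 : (|y| + |x| + ac d m) ^ 2 ≤ 3 * (x ^ 2 + y ^ 2 + ac d m ^ 2) := by
      rw [← sq_abs x, ← sq_abs y]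
      nlinarith [sq_nonneg (|y| - |x|), sq_nonneg (|y| - ac d m), sq_nonneg (|x| - ac d m)]
    calc _ ≤ _ := h2.trans h4
      _ = d.B ^ 2 * (|y| + |x| + ac d m) ^ 2 := by ring
      _ ≤ d.B ^ 2 * (3 * (x ^ 2 + y ^ 2 + ac d m ^ 2)) := by gcongr
      _ = _ := by ring
  have k1 := key _ (d.X_bound (y / gg d m x))
  have k2 := key _ (d.Y_bound (y / gg d m x))
  unfold Nn Kc rsq
  simp only
  have e : (gg d m x * (m * d.Y (d.k (y / gg d m x)))) ^ 2 =
    m ^ 2 * (gg d m x * d.Y (d.k (y / gg d m x))) ^ 2 := by ring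
  rw [e]
  nlinarith [mul_le_mul_of_nonneg_left k2 (sq_nonneg m), sq_nonneg y, sq_nonneg (ac d m)]

lemma chi_nonneg (p : ℝ × ℝ) : 0 ≤ chi p := Real.smoothTransition.nonneg _
lemma chi_le (p : ℝ × ℝ) : chi p ≤ 1 := Real.smoothTransition.le_one _

lemma chi_pos (p : ℝ × ℝ) (h : chi p ≠ 0) : 1 / 2 < rsq p := by
  by_contra hh
  apply h
  unfold chi
  exact Real.smoothTransition.zero_of_nonpos (by linarith)

lemma chi_one (p : ℝ × ℝ) (h : rsq p = 1) : chi p = 1 := by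
  unfold chi
  exact Real.smoothTransition.one_of_one_le (by linarith)

lemma ac_sq_le : ac d m ^ 2 ≤ 1 / 32 := by
  have := ac_sq d m
  nlinarith [Kc_ge d m, sq_nonneg (ac d m)]

lemma inU_of (p : ℝ × ℝ) (h : 2 * ac d m ^ 2 ≤ rsq p) : inU d m p := by
  by_contra hh
  unfold inU at hh
  push Not at hh
  have h1 : p.1 ^ 2 < ac d m ^ 2 := sq_lt_sq' (by linarith [(abs_lt.mp hh.1).1]) (abs_lt.mp hh.1).2
  have h2 : p.2 ^ 2 < ac d m ^ 2 := sq_lt_sq' (by linarith [(abs_lt.mp hh.2).1]) (abs_lt.mp hh.2).2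
  unfold rsq at h
  linarith

lemma chi_facts (p : ℝ × ℝ) (h : chi p ≠ 0) :
    inU d m p ∧ 0 < rsq p ∧ 0 < Nn d m p / rsq p ∧ Nn d m p / rsq p ≤ 2 * Kc d m := by
  have h1 := chi_pos p h
  have h2 := ac_sq_le d m
  have h3 : inU d m p := inU_of d m p (by linarith)
  have h4 : 0 < rsq p := by linarith
  refine ⟨h3, h4, div_pos (Nn_pos d m p h3) h4, ?_⟩
  rw [div_le_iff₀ h4]
  have := Nn_le d m p
  have := Kc_pos d m
  nlinarith

lemma EE_le (p : ℝ × ℝ) : EE d m p ≤ 2 * Kc d m := by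
  unfold EE
  by_cases h : chi p = 0
  · rw [h]; linarith
  · obtain ⟨_, _, _, h4⟩ := chi_facts d m p h
    nlinarith [chi_nonneg p]

lemma EE_pos (p : ℝ × ℝ) : 0 < EE d m p := by
  unfold EE
  have := Kc_pos d m
  by_cases h : chi p = 0
  · rw [h]; linarith
  · obtain ⟨_, _, h3, h4⟩ := chi_facts d m p h
    nlinarith [chi_nonneg p, chi_le p]

lemma EE_anti (p : ℝ × ℝ) (s : ℝ) (hs : 1 ≤ s) : EE d m (s * p.1, s * p.2) ≤ EE d m p := by
  by_cases h : chi p = 0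
  · have : EE d m p = 2 * Kc d m := by unfold EE; rw [h]; ring
    rw [this]; exact EE_le d m _
  · obtain ⟨h1, h2, h3, h4⟩ := chi_facts d m p h
    have e1 : rsq (s * p.1, s * p.2) = s ^ 2 * rsq p := by unfold rsq; ring
    have e2 : Nn d m (s * p.1, s * p.2) / rsq (s * p.1, s * p.2) = Nn d m p / rsq p := by
      rw [Nn_smul d m p s hs h1, e1, mul_div_mul_left _ _ (by positivity)]
    have e3 : chi p ≤ chi (s * p.1, s * p.2) := by
      unfold chi
      apply Real.smoothTransition.monotone
      rw [e1]
      have : 1 ≤ s ^ 2 := by nlinarith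
      nlinarith
    unfold EE
    rw [e2]
    nlinarith

lemma rsq_smooth : ContDiff ℝ (⊤ : ℕ∞) rsq := by unfold rsq; fun_prop

lemma chi_smooth : ContDiff ℝ (⊤ : ℕ∞) chi := by
  unfold chi
  exact Real.smoothTransition.contDiff.comp ((contDiff_const.mul rsq_smooth).sub contDiff_const)

lemma Nn_smooth : ContDiff ℝ (⊤ : ℕ∞) (Nn d m) := by
  have h1 : ContDiff ℝ (⊤ : ℕ∞) (fun p : ℝ × ℝ => gg d m p.1) :=
    (gg_smooth d m).comp contDiff_fst
  have h2 : ContDiff ℝ (⊤ : ℕ∞) (fun p : ℝ × ℝ => d.k (p.2 / gg d m p.1)) :=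
    d.k_smooth.comp (contDiff_snd.div h1 fun p => (gg_pos d m _).ne')
  have h3 := d.X_smooth.comp h2
  have h4 := d.Y_smooth.comp h2
  unfold Nn
  exact ((contDiff_fst.pow 2).add ((h1.mul h3).pow 2)).add
    ((h1.mul (contDiff_const.mul h4)).pow 2)

lemma EE_smooth : ContDiff ℝ (⊤ : ℕ∞) (EE d m) := by
  rw [contDiff_iff_contDiffAt]
  intro p
  by_cases h : rsq p < 1 / 2
  · have : ∀ᶠ q in nhds p, rsq q < 1 / 2 :=
      rsq_smooth.continuous.continuousAt.eventually (gt_mem_nhds h)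
    have hc : ContDiffAt ℝ (⊤ : ℕ∞) (fun _ : ℝ × ℝ => 2 * Kc d m) p := contDiffAt_const
    refine hc.congr_of_eventuallyEq ?_
    filter_upwards [this] with q hq
    have : chi q = 0 := by
      by_contra h; linarith [chi_pos q h]
    unfold EE; rw [this]; ring
  · have h0 : rsq p ≠ 0 := by intro h'; rw [h'] at h; norm_num at h
    unfold EE
    exact contDiffAt_const.sub (chi_smooth.contDiffAt.mul (contDiffAt_const.sub
      ((Nn_smooth d m).contDiffAt.div rsq_smooth.contDiffAt h0)))

lemma lam_smooth : ContDiff ℝ (⊤ : ℕ∞) (lam d m) := by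
  unfold lam
  exact contDiff_const.div ((EE_smooth d m).sqrt fun p => (EE_pos d m p).ne')
    fun p => (Real.sqrt_pos.mpr (EE_pos d m p)).ne'

lemma lam_pos (p : ℝ × ℝ) : 0 < lam d m p := by
  have := Real.sqrt_pos.mpr (EE_pos d m p)
  unfold lam; positivity

lemma lam_sq (p : ℝ × ℝ) : lam d m p ^ 2 * EE d m p = 1 := by
  have h := EE_pos d m p
  unfold lam
  rw [div_pow, Real.sq_sqrt h.le]; field_simp

lemma lam_mono (p : ℝ × ℝ) (s : ℝ) (hs : 1 ≤ s) :
    lam d m p ≤ lam d m (s * p.1, s * p.2) := by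
  unfold lam
  apply one_div_le_one_div_of_le (Real.sqrt_pos.mpr (EE_pos d m _))
  exact Real.sqrt_le_sqrt (EE_anti d m p s hs)

lemma lam_radial (x y : ℝ) :
    0 ≤ x * dx (lam d m) (x, y) + y * dy (lam d m) (x, y) := by
  have hmono : Monotone (fun t : ℝ => lam d m (Real.exp t * x, Real.exp t * y)) := by
    intro t u htu
    have := lam_mono d m (Real.exp t * x, Real.exp t * y) (Real.exp (u - t))
      (Real.one_le_exp (by linarith))
    simp only [← mul_assoc, ← Real.exp_add, sub_add_cancel] at this
    exact this
  have h1 : HasFDerivAt (lam d m) (fderiv ℝ (lam d m) (x, y))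
      (Real.exp 0 * x, Real.exp 0 * y) := by
    simp only [Real.exp_zero, one_mul]
    exact (((lam_smooth d m).differentiable (by simp)) (x, y)).hasFDerivAt
  have h2 : HasDerivAt (fun t : ℝ => (Real.exp t * x, Real.exp t * y)) (x, y) 0 := by
    have := ((Real.hasDerivAt_exp 0).mul_const x).prodMk ((Real.hasDerivAt_exp 0).mul_const y)
    simpa using this
  have h3 := h1.comp_hasDerivAt (0:ℝ) h2
  have h4 : fderiv ℝ (lam d m) (x, y) (x, y) =
      x * dx (lam d m) (x, y) + y * dy (lam d m) (x, y) := by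
    rw [dx_eq _ (lam_smooth d m), dy_eq _ (lam_smooth d m)]
    have : ((x, y) : ℝ × ℝ) = x • ((1:ℝ), (0:ℝ)) + y • ((0:ℝ), (1:ℝ)) := by simp
    conv_lhs => rw [show fderiv ℝ (lam d m) (x, y) (x, y) =
      fderiv ℝ (lam d m) (x, y) (x • ((1:ℝ), (0:ℝ)) + y • ((0:ℝ), (1:ℝ))) by rw [← this]]
    rw [map_add, map_smul, map_smul]; simp
  rw [← h4, ← h3.deriv]
  exact hmono.deriv_nonneg

lemma AA_smooth : ContDiff ℝ (⊤ : ℕ∞) (AA d m) := by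
  unfold AA
  exact (lam_smooth d m).mul contDiff_fst

lemma cc_smooth : ContDiff ℝ (⊤ : ℕ∞) (cc d m) := by
  unfold cc
  exact d.k_smooth.comp (((lam_smooth d m).mul contDiff_snd).div
    ((gg_smooth d m).comp (AA_smooth d m)) fun p => (gg_pos d m _).ne')

lemma c_der {q A : ℝ → ℝ} {q' A' t : ℝ} (hq : HasDerivAt q q' t) (hA : HasDerivAt A A' t) :
    HasDerivAt (fun t => d.k (q t / gg d m (A t))) (d.k1 (q t / gg d m (A t)) *
      ((q' * gg d m (A t) - q t * (d.s (A t / ac d m) * A')) / gg d m (A t) ^ 2)) t :=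
  (d.k_der _).comp t (hq.div ((gg_der d m (A t)).comp t hA) (gg_pos d m _).ne')

lemma jac (p : ℝ × ℝ) :
    dx (AA d m) p * dy (cc d m) p - dy (AA d m) p * dx (cc d m) p ≠ 0 := by
  obtain ⟨x, y⟩ := p
  have hl := lam_smooth d m
  have lx := has_dx _ hl x y
  have ly := has_dy _ hl x y
  have Ax := lx.mul (hasDerivAt_id x)
  have Ay := ly.mul_const x
  have qx := lx.mul_const y
  have qy := ly.mul (hasDerivAt_id y)
  have eAx : dx (AA d m) (x, y) = dx (lam d m) (x, y) * x + lam d m (x, y) * 1 := Ax.deriv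
  have eAy : dy (AA d m) (x, y) = dy (lam d m) (x, y) * x := Ay.deriv
  have hAx := has_dx _ (AA_smooth d m) x y
  have hAy := has_dy _ (AA_smooth d m) x y
  have g0 := (gg_pos d m (AA d m (x, y)))
  have ecx : dx (cc d m) (x, y) = _ := (c_der d m qx hAx).deriv
  have ecy : dy (cc d m) (x, y) = _ := (c_der d m qy hAy).deriv
  have hr := lam_radial d m x y
  have h0 := lam_pos d m (x, y)
  have hk := d.k1_pos (lam d m (x, y) * y / gg d m (AA d m (x, y)))
  have : dx (AA d m) (x, y) * dy (cc d m) (x, y) - dy (AA d m) (x, y) * dx (cc d m) (x, y) =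
      d.k1 (lam d m (x, y) * y / gg d m (AA d m (x, y))) / gg d m (AA d m (x, y)) *
      (lam d m (x, y) * (lam d m (x, y) + (x * dx (lam d m) (x, y) + y * dy (lam d m) (x, y)))) := by
    rw [ecx, ecy, eAx, eAy]
    simp only [Function.comp, id, Pi.mul_apply]
    field_simp
    ring
  rw [this]
  positivity

lemma rsq_disk (p : ℝ × ℝ) : p ∈ ClosedDisk ↔ rsq p ≤ 1 := by
  change √(rsq p) ≤ 1 ↔ _
  rw [Real.sqrt_le_one]

lemma rsq_norm2 (p : ℝ × ℝ) : norm2 p = 1 ↔ rsq p = 1 := by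
  change √(rsq p) = 1 ↔ _
  rw [Real.sqrt_eq_one]

lemma norm3_psi (p : ℝ × ℝ) :
    norm3 (psi d m p) = √(Nn d m (lam d m p * p.1, lam d m p * p.2)) := rfl

lemma rsq_lam (p : ℝ × ℝ) :
    rsq (lam d m p * p.1, lam d m p * p.2) = lam d m p ^ 2 * rsq p := by
  unfold rsq; ring

lemma lam_ge (p : ℝ × ℝ) : 1 ≤ lam d m p ^ 2 * (2 * Kc d m) := by
  rw [← lam_sq d m p]
  have := EE_le d m p
  gcongr

lemma Nn_lam (p : ℝ × ℝ) (h : inU d m p) (h' : inU d m (lam d m p * p.1, lam d m p * p.2)) :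
    Nn d m (lam d m p * p.1, lam d m p * p.2) = lam d m p ^ 2 * Nn d m p := by
  have hl := lam_pos d m p
  rcases le_total 1 (lam d m p) with h1 | h1
  · exact Nn_smul d m p _ h1 h
  · have := Nn_smul d m _ (lam d m p)⁻¹ (one_le_inv₀ hl |>.mpr h1) h'
    simp only [inv_mul_cancel_left₀ hl.ne'] at this
    rw [show Nn d m p = Nn d m (p.1, p.2) from rfl, this]
    field_simp

lemma small_N (q : ℝ × ℝ) (h : rsq q ≤ 2 * ac d m ^ 2) : Nn d m q < 1 := by
  have h1 := Nn_le d m q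
  have h2 := ac_sq d m
  have h3 := Kc_pos d m
  have : Kc d m * (rsq q + ac d m ^ 2) ≤ Kc d m * (3 * ac d m ^ 2) := by gcongr; linarith
  nlinarith

lemma not_small (p : ℝ × ℝ) (h : 2 * ac d m ^ 2 < lam d m p ^ 2 * rsq p) :
    2 * ac d m ^ 2 ≤ rsq p := by
  by_contra hh
  push Not at hh
  have hχ : chi p = 0 := by
    by_contra h
    linarith [chi_pos p h, ac_sq_le d m]
  have hE : EE d m p = 2 * Kc d m := by unfold EE; rw [hχ]; ring
  have h1 := lam_sq d m p
  rw [hE] at h1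
  have h2 := Kc_ge d m
  have h3 : lam d m p ^ 2 ≤ 1 := by nlinarith [sq_nonneg (lam d m p)]
  have h4 : 0 ≤ rsq p := by unfold rsq; positivity
  nlinarith

lemma N_le_E (p : ℝ × ℝ) (h : inU d m p) : Nn d m p ≤ EE d m p * rsq p := by
  have ha := ac_pos d m
  have h0 : ac d m ^ 2 ≤ rsq p := by
    unfold rsq
    rcases h with h | h
    · nlinarith [sq_abs p.1, sq_nonneg p.2]
    · nlinarith [sq_abs p.2, sq_nonneg p.1]
  have hr : 0 < rsq p := lt_of_lt_of_le (by positivity) h0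
  have h1 := Nn_le d m p
  have h2 := Kc_pos d m
  have h3 : Nn d m p / rsq p ≤ 2 * Kc d m := by
    rw [div_le_iff₀ hr]; nlinarith
  rw [← div_le_iff₀ hr]
  unfold EE
  nlinarith [chi_nonneg p, chi_le p]

lemma bdry_inU (p : ℝ × ℝ) (h : rsq p = 1) :
    inU d m p ∧ inU d m (lam d m p * p.1, lam d m p * p.2) := by
  constructor
  · apply inU_of; linarith [ac_sq_le d m]
  · apply inU_of
    rw [rsq_lam, h]
    have h1 := lam_ge d m p
    have h2 := ac_sq d m
    have h3 := Kc_pos d m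
    by_contra hh
    push Not at hh
    nlinarith

lemma bdry_E (p : ℝ × ℝ) (h : rsq p = 1) : EE d m p = Nn d m p := by
  unfold EE; rw [chi_one p h, h]; ring

lemma N_bdry (p : ℝ × ℝ) (h : rsq p = 1) :
    Nn d m (lam d m p * p.1, lam d m p * p.2) = 1 := by
  obtain ⟨h1, h2⟩ := bdry_inU d m p h
  rw [Nn_lam d m p h1 h2, ← bdry_E d m p h, lam_sq]

lemma N_int (p : ℝ × ℝ) (h : rsq p < 1) :
    Nn d m (lam d m p * p.1, lam d m p * p.2) < 1 := by
  rcases le_or_gt (rsq (lam d m p * p.1, lam d m p * p.2)) (2 * ac d m ^ 2) with h1 | h1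
  · exact small_N d m _ h1
  · have h2 := inU_of d m _ h1.le
    have h3 := inU_of d m p (not_small d m p (by rwa [rsq_lam] at h1))
    rw [Nn_lam d m p h3 h2]
    have h4 := N_le_E d m p h3
    have h5 := lam_sq d m p
    calc lam d m p ^ 2 * Nn d m p ≤ lam d m p ^ 2 * (EE d m p * rsq p) := by gcongr
      _ = rsq p := by rw [← mul_assoc, h5, one_mul]
      _ < 1 := h

lemma norm_iff (p : ℝ × ℝ) (h : p ∈ ClosedDisk) :
    norm3 (psi d m p) ≤ 1 ∧ (norm3 (psi d m p) = 1 ↔ norm2 p = 1) := by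
  rw [rsq_disk] at h
  rw [norm3_psi, rsq_norm2, Real.sqrt_le_one, Real.sqrt_eq_one]
  rcases h.lt_or_eq with h | h
  · have := N_int d m p h
    exact ⟨this.le, fun h' => absurd h' this.ne, fun h' => absurd h' h.ne⟩
  · have := N_bdry d m p h
    exact ⟨this.le, fun _ => h, fun _ => this⟩

lemma ac_lt_one : ac d m < 1 := by
  have := ac_sq_le d m
  nlinarith [ac_pos d m]

lemma lam_01 (y : ℝ) (hy : y ^ 2 = 1) : lam d m (0, y) = 1 / √(1 + m ^ 2) := by
  have hr : rsq (0, y) = 1 := by simp [rsq, hy]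
  have ha := ac_pos d m
  have hy1 : |y| = 1 := by rw [← sq_abs] at hy; nlinarith [abs_nonneg y]
  unfold lam
  rw [bdry_E d m _ hr, Nn_tail d m 0 y
    (tail_ge d m 0 y (by simp [ha]) (by rw [hy1]; exact (ac_lt_one d m).le)), hy]
  norm_num

lemma psi_01 (y : ℝ) (hy : y ^ 2 = 1) :
    psi d m (0, y) = (0, -(1 / √(1 + m ^ 2)), -(m * (1 / √(1 + m ^ 2) * y))) := by
  have hr : rsq (0, y) = 1 := by simp [rsq, hy]
  have ha := ac_pos d m
  have hy1 : |y| = 1 := by rw [← sq_abs] at hy; nlinarith [abs_nonneg y]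
  have hU := (bdry_inU d m _ hr).2
  have hl := lam_01 d m y hy
  have hlp := lam_pos d m (0, y)
  have hA : AA d m (0, y) = 0 := by simp [AA]
  have hg := gg_pos d m 0
  have h1 : ac d m ≤ |lam d m (0, y) * y| := by
    rcases hU with h | h
    · simp at h; linarith
    · exact h
  have h2 := tail_ge d m 0 _ (by simp [ha]) h1
  unfold psi patch cc
  rw [hA]
  simp only
  rw [d.X_tail _ h2, d.Y_tail _ h2, ← hl, abs_div, abs_mul, hy1, abs_of_pos hlp, abs_of_pos hg]
  refine Prod.ext rfl (Prod.ext ?_ ?_)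
  · simp only; field_simp
  · simp only; field_simp

lemma psi_00 : psi d m (0, 0) = (0, gg d m 0 * d.X (d.k 0), 0) := by
  have hA : AA d m (0, 0) = 0 := by simp [AA]
  unfold psi patch cc
  rw [hA]
  simp [d.Y_zero]

lemma psi_10 : psi d m (1, 0) =
    (lam d m (1, 0), gg d m (lam d m (1, 0)) * d.X (d.k 0), 0) := by
  have hA : AA d m (1, 0) = lam d m (1, 0) := by simp [AA]
  unfold psi patch cc
  rw [hA]
  simp [d.Y_zero]

lemma psi_smooth : ContDiff ℝ (⊤ : ℕ∞) (psi d m) := by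
  unfold psi patch
  have hA := AA_smooth d m
  have hc := cc_smooth d m
  have hg := (gg_smooth d m).comp hA
  exact hA.prodMk ((hg.mul (d.X_smooth.comp hc)).prodMk
    (hg.mul (contDiff_const.mul (d.Y_smooth.comp hc))))

lemma psi_good (hm : 0 < m) : IsFreeBoundarySaddleDiskNonEquatorial (psi d m) := by
  have hA := AA_smooth d m
  have hc := cc_smooth d m
  have hY : ∀ t, HasDerivAt (fun t => m * d.Y t) (m * d.Y1 t) t := fun t => (d.Y_der t).const_mul m
  have hY1 : ∀ t, HasDerivAt (fun t => m * d.Y1 t) (m * d.Y2 t) t :=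
    fun t => (d.Y1_der t).const_mul m
  refine ⟨psi_smooth d m, fun p hp => (norm_iff d m p hp).1, fun p _ => ?_,
    fun p hp => (norm_iff d m p hp).2, fun p _ hp => ?_, fun p _ => ?_, ?_⟩
  · exact patch_immersion hA hc (gg_der d m) d.X_der hY (gg_pos d m)
      (fun t => (d.reg t).imp id (fun h => mul_ne_zero hm.ne' h)) p (jac d m p)
  · refine patch_free hA hc (gg_der d m) d.X_der hY p ?_
    rw [rsq_norm2] at hp
    have hU := (bdry_inU d m p hp).2
    by_cases h : ac d m ≤ |AA d m p|
    · left; exact gg_cone d m _ h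
    · right
      have h1 := d.W_zero _ (tail_ge d m _ _ h (hU.resolve_left h))
      unfold cc
      linear_combination m * h1
  · refine patch_saddle hA hc (gg_der d m) d.X_der hY (g1_der d m) d.X1_der hY1 (gg_pos d m)
      (fun t => div_nonneg (d.H2_nonneg _) (ac_pos d m).le) (fun t => ?_) (fun t => ?_) p
    · have := mul_nonneg hm.le (d.W_nonneg t); linarith
    · have := mul_nonneg hm.le (d.V_nonneg t); linarith
  · rintro ⟨⟨w1, w2, w3⟩, b, hw, h⟩
    have e0 := h (0, 0) (by rw [rsq_disk]; norm_num [rsq])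
    have e1 := h (1, 0) (by rw [rsq_disk]; norm_num [rsq])
    have e2 := h (0, 1) (by rw [rsq_disk]; norm_num [rsq])
    have e3 := h (0, -1) (by rw [rsq_disk]; norm_num [rsq])
    rw [psi_00] at e0
    rw [psi_10] at e1
    rw [psi_01 d m 1 (by norm_num)] at e2
    rw [psi_01 d m (-1) (by norm_num)] at e3
    have hL : 0 < 1 / √(1 + m ^ 2) := by positivity
    generalize 1 / √(1 + m ^ 2) = L at *
    have hg := gg_pos d m 0
    have hX := d.X_zero
    have hl := lam_pos d m (1, 0)
    simp only [dot3] at e0 e1 e2 e3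
    have f3 : w3 = 0 := by
      have : w3 * (m * L) = 0 := by linear_combination (e3 - e2) / 2
      exact (mul_eq_zero.mp this).resolve_right (by positivity)
    have f2 : w2 = 0 := by
      have : w2 * (gg d m 0 * d.X (d.k 0) + L) = 0 := by linear_combination e0 - (e2 + e3) / 2
      exact (mul_eq_zero.mp this).resolve_right (by positivity)
    have f1 : w1 = 0 := by
      subst f2
      have : w1 * lam d m (1, 0) = 0 := by linear_combination e1 - e0
      exact (mul_eq_zero.mp this).resolve_right (by positivity)
    exact hw (by rw [f1, f2, f3]; rfl)

lemma psi_inj (m' : ℝ) (hm : 0 < m) (hm' : 0 < m')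
    (h : psi d m '' ClosedDisk = psi d m' '' ClosedDisk) : m = m' := by
  have h1 : psi d m (0, 1) ∈ psi d m '' ClosedDisk :=
    ⟨(0, 1), by rw [rsq_disk]; norm_num [rsq], rfl⟩
  have hn : norm3 (psi d m (0, 1)) = 1 := by
    refine (norm_iff d m (0, 1) ?_).2.mpr ?_
    · rw [rsq_disk]; norm_num [rsq]
    · rw [rsq_norm2]; norm_num [rsq]
  rw [h] at h1
  obtain ⟨⟨x, y⟩, hp, e⟩ := h1
  have hr : rsq (x, y) = 1 := by
    rw [← rsq_norm2, ← (norm_iff d m' _ hp).2, e, hn]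
  rw [psi_01 d m 1 (by norm_num)] at e
  have ex : lam d m' (x, y) * x = 0 := congrArg Prod.fst e
  have hx : x = 0 := (mul_eq_zero.mp ex).resolve_left (lam_pos d m' _).ne'
  subst hx
  rw [psi_01 d m' y (by simpa [rsq] using hr)] at e
  have e2 : -(1 / √(1 + m' ^ 2)) = -(1 / √(1 + m ^ 2)) := congrArg (fun z => z.2.1) e
  rw [neg_inj, one_div, one_div, inv_inj, Real.sqrt_inj (by positivity) (by positivity)] at e2
  nlinarith

end Surface

/-- **Theorem 1.1.** There exist infinitely many `C^∞` free boundary saddle disks in the unit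
ball of `ℝ³` which are not equatorial: there is a sequence of such disks with pairwise
distinct images. -/
theorem exists_infinitely_many_free_boundary_saddle_disks :
    ∃ Ψ : ℕ → (ℝ × ℝ) → ℝ × ℝ × ℝ,
      (∀ n, IsFreeBoundarySaddleDiskNonEquatorial (Ψ n)) ∧
      Function.Injective (fun n => (Ψ n) '' ClosedDisk) := by
  obtain ⟨d⟩ := curveData_nonempty
  refine ⟨fun n => psi d ((n : ℝ) + 1), fun n => psi_good d _ (by positivity), ?_⟩
  intro n n' h
  have := psi_inj d ((n : ℝ) + 1) ((n' : ℝ) + 1) (by positivity) (by positivity) h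
  exact_mod_cast add_right_cancel this
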